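/- Fix 0 < β < 1/2 and let f_β(x) = x^{−β} 1_{(0,1]}(x). For every j ≥ 0: the Haar coefficient β_{(j,k)} = ∫ f_β ψ_{j,k} equals 0 whenever k ∉ {0, 1, …, 2^j − 1}, and for every k ∈ {0, 1, …, 2^j − 1}, β_{(j,k)} = (1−β)^{−1} 2^{−j(1/2−β)} ( 2(k + 1/2)^{1−β} − k^{1−β} − (k+1)^{1−β} ), and moreover β_{(j,k)} > 0. -/

import Mathlib

open MeasureTheory Real

/-- The Haar scaling function `φ = 1_{[0,1)}`. -/
noncomputable def haarPhi (x : ℝ) : ℝ := if 0 ≤ x ∧ x < 1 then 1 else 0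

/-- The Haar wavelet `ψ = 1_{[0,1/2)} - 1_{[1/2,1)}`. -/
noncomputable def haarPsi (x : ℝ) : ℝ :=
  if 0 ≤ x ∧ x < 1 / 2 then 1 else if 1 / 2 ≤ x ∧ x < 1 then -1 else 0

/-- The dilated-translated Haar wavelet `ψ_{j,k}(x) = 2^{j/2} ψ(2^j x - k)` for `j ≥ 0`. -/
noncomputable def haarPsiJK (j : ℕ) (k : ℤ) (x : ℝ) : ℝ :=
  (2 : ℝ) ^ ((j : ℝ) / 2) * haarPsi ((2 : ℝ) ^ j * x - (k : ℝ))

/-- The translated Haar scaling function `φ_k(x) = φ(x - k)`. -/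
noncomputable def haarPhiK (k : ℤ) (x : ℝ) : ℝ := haarPhi (x - (k : ℝ))

/-- Scaling (level `j = -1`) Haar coefficient `β_{(-1,k)} = ∫ f φ_k`. -/
noncomputable def betaS (f : ℝ → ℝ) (k : ℤ) : ℝ := ∫ x, f x * haarPhiK k x

/-- Wavelet (level `j ≥ 0`) Haar coefficient `β_{(j,k)} = ∫ f ψ_{j,k}`. -/
noncomputable def betaW (f : ℝ → ℝ) (j : ℕ) (k : ℤ) : ℝ := ∫ x, f x * haarPsiJK j k x

/-- `σ_{(-1,k)} = (∫ φ_k² f)^{1/2}`. -/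
noncomputable def sigmaS (f : ℝ → ℝ) (k : ℤ) : ℝ :=
  Real.sqrt (∫ x, (haarPhiK k x) ^ 2 * f x)

/-- `σ_{(j,k)} = (∫ ψ_{j,k}² f)^{1/2}` for `j ≥ 0`. -/
noncomputable def sigmaW (f : ℝ → ℝ) (j : ℕ) (k : ℤ) : ℝ :=
  Real.sqrt (∫ x, (haarPsiJK j k x) ^ 2 * f x)

/-- The function `f_β(x) = x^{-β} 1_{(0,1]}(x)`. -/
noncomputable def fBeta (b : ℝ) (x : ℝ) : ℝ := if 0 < x ∧ x ≤ 1 then x ^ (-b) else 0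

/-- Almost everywhere, `f_β ψ_{j,k}` is a multiple of the difference of the restrictions of
`x ↦ x^{-β}` to the two halves of the dyadic interval supporting `ψ_{j,k}`. -/
lemma fBeta_mul_haarPsiJK_ae_eq (b : ℝ) (j : ℕ) (k : ℤ) (hk0 : 0 ≤ k) (hk : k < (2 : ℤ) ^ j) :
    (fun x => fBeta b x * haarPsiJK j k x) =ᵐ[volume] fun x => (2 : ℝ) ^ ((j : ℝ) / 2) *
      ((Set.Ioc ((k : ℝ) / 2 ^ j) (((k : ℝ) + 1 / 2) / 2 ^ j)).indicator (fun x => x ^ (-b)) x -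
        (Set.Ioc (((k : ℝ) + 1 / 2) / 2 ^ j) (((k : ℝ) + 1) / 2 ^ j)).indicator
          (fun x => x ^ (-b)) x) := by
  have hN : (0 : ℝ) < 2 ^ j := by positivity
  have hk0' : (0 : ℝ) ≤ k := by exact_mod_cast hk0
  have hk' : (k : ℝ) + 1 ≤ 2 ^ j := by exact_mod_cast hk
  filter_upwards [Measure.ae_ne volume ((k : ℝ) / 2 ^ j),
    Measure.ae_ne volume (((k : ℝ) + 1 / 2) / 2 ^ j),
    Measure.ae_ne volume (((k : ℝ) + 1) / 2 ^ j)] with x h1 h2 h3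
  simp only [ne_eq, eq_div_iff hN.ne'] at h1 h2 h3
  have hpos : 0 < 2 ^ j * x → 0 < x := fun h => (mul_pos_iff_of_pos_left hN).1 h
  have hle : 2 ^ j * x ≤ 2 ^ j → x ≤ 1 := fun h => by nlinarith
  rw [mul_comm x] at h1 h2 h3
  simp only [fBeta, haarPsiJK, haarPsi, Set.indicator_apply, Set.mem_Ioc, div_lt_iff₀ hN,
    le_div_iff₀ hN, mul_comm x]
  generalize (2 : ℝ) ^ j * x = y at *
  rcases lt_or_gt_of_ne h1 with h1 | h1
  · rw [if_neg (c := 0 ≤ y - k ∧ _) (by rintro ⟨h, -⟩; linarith),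
      if_neg (c := 1 / 2 ≤ y - k ∧ _) (by rintro ⟨h, -⟩; linarith),
      if_neg (c := (k : ℝ) < y ∧ _) (by rintro ⟨h, -⟩; linarith),
      if_neg (c := (k : ℝ) + 1 / 2 < y ∧ _) (by rintro ⟨h, -⟩; linarith)]
    simp
  rcases lt_or_gt_of_ne h3 with h3 | h3
  · rw [if_pos (c := 0 < x ∧ x ≤ 1) ⟨hpos (by linarith), hle (by linarith)⟩]
    rcases lt_or_gt_of_ne h2 with h2 | h2
    · rw [if_pos (c := 0 ≤ y - k ∧ _) ⟨by linarith, by linarith⟩,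
        if_pos (c := (k : ℝ) < y ∧ _) ⟨by linarith, by linarith⟩,
        if_neg (c := (k : ℝ) + 1 / 2 < y ∧ _) (by rintro ⟨h, -⟩; linarith)]
      ring
    · rw [if_neg (c := 0 ≤ y - k ∧ _) (by rintro ⟨-, h⟩; linarith),
        if_pos (c := 1 / 2 ≤ y - k ∧ _) ⟨by linarith, by linarith⟩,
        if_neg (c := (k : ℝ) < y ∧ _) (by rintro ⟨-, h⟩; linarith),
        if_pos (c := (k : ℝ) + 1 / 2 < y ∧ _) ⟨by linarith, by linarith⟩]
      ring
  · rw [if_neg (c := 0 ≤ y - k ∧ _) (by rintro ⟨-, h⟩; linarith),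
      if_neg (c := 1 / 2 ≤ y - k ∧ _) (by rintro ⟨-, h⟩; linarith),
      if_neg (c := (k : ℝ) < y ∧ _) (by rintro ⟨-, h⟩; linarith),
      if_neg (c := (k : ℝ) + 1 / 2 < y ∧ _) (by rintro ⟨-, h⟩; linarith)]
    simp

lemma betaW_fBeta_eq_zero (b : ℝ) (j : ℕ) (k : ℤ) (hk : k < 0 ∨ (2 : ℤ) ^ j ≤ k) :
    betaW (fBeta b) j k = 0 := by
  have hN : (0 : ℝ) < 2 ^ j := by positivity
  refine integral_eq_zero_of_ae ?_
  filter_upwards [Measure.ae_ne volume (1 : ℝ)] with x hx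
  by_cases hx01 : 0 < x ∧ x ≤ 1
  · have hx0 : 0 < 2 ^ j * x := mul_pos hN hx01.1
    have hx1 : 2 ^ j * x < 2 ^ j := mul_lt_of_lt_one_right hN (lt_of_le_of_ne hx01.2 hx)
    have hψ : haarPsi (2 ^ j * x - k) = 0 := by
      rcases hk with hk | hk
      · have hk' : (k : ℝ) + 1 ≤ 0 := by exact_mod_cast hk
        rw [haarPsi, if_neg (by rintro ⟨-, h⟩; linarith), if_neg (by rintro ⟨-, h⟩; linarith)]
      · have hk' : (2 : ℝ) ^ j ≤ k := by exact_mod_cast hk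
        rw [haarPsi, if_neg (by rintro ⟨h, -⟩; linarith), if_neg (by rintro ⟨h, -⟩; linarith)]
    simp [haarPsiJK, hψ]
  · simp [fBeta, hx01]

lemma betaW_fBeta_eq (b : ℝ) (hb : b < 1) (j : ℕ) (k : ℤ) (hk0 : 0 ≤ k) (hk : k < (2 : ℤ) ^ j) :
    betaW (fBeta b) j k =
      (1 - b)⁻¹ * (2 : ℝ) ^ (-(j : ℝ) * (1 / 2 - b)) *
        (2 * ((k : ℝ) + 1 / 2) ^ (1 - b) - (k : ℝ) ^ (1 - b) - ((k : ℝ) + 1) ^ (1 - b)) := by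
  have hN : (0 : ℝ) < 2 ^ j := by positivity
  have hk0' : (0 : ℝ) ≤ k := by exact_mod_cast hk0
  have hr : -1 < -b := by linarith
  have hint : ∀ u v : ℝ, Integrable ((Set.Ioc u v).indicator fun x : ℝ => x ^ (-b)) := fun u v =>
    (integrable_indicator_iff measurableSet_Ioc).2
      (intervalIntegral.intervalIntegrable_rpow' hr).1
  have hval : ∀ u v : ℝ, u ≤ v → ∫ x, (Set.Ioc u v).indicator (fun x : ℝ => x ^ (-b)) x =
      (v ^ (1 - b) - u ^ (1 - b)) / (1 - b) := fun u v huv => by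
    rw [integral_indicator measurableSet_Ioc, ← intervalIntegral.integral_of_le huv,
      integral_rpow (Or.inl hr), neg_add_eq_sub]
  have hpow : (2 : ℝ) ^ (-(j : ℝ) * (1 / 2 - b)) =
      (2 : ℝ) ^ ((j : ℝ) / 2) / ((2 : ℝ) ^ j) ^ (1 - b) := by
    rw [← rpow_natCast, ← rpow_mul zero_le_two, ← rpow_sub zero_lt_two]
    ring_nf
  rw [betaW, integral_congr_ae (fBeta_mul_haarPsiJK_ae_eq b j k hk0 hk), integral_const_mul,
    integral_sub (hint _ _) (hint _ _), hval _ _ (by gcongr; linarith),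
    hval _ _ (by gcongr; norm_num), hpow, div_rpow hk0' hN.le,
    div_rpow (by linarith) hN.le, div_rpow (by linarith) hN.le]
  ring

/-- Strict midpoint concavity of `x ↦ x^p` on `[0, ∞)`. -/
lemma two_mul_midpoint_rpow_sub_pos {p : ℝ} (hp0 : 0 < p) (hp1 : p < 1) {x : ℝ} (hx : 0 ≤ x) :
    0 < 2 * (x + 1 / 2) ^ p - x ^ p - (x + 1) ^ p := by
  have hx1 : x + 1 ∈ Set.Ici (0 : ℝ) := Set.mem_Ici.2 (by linarith)
  have h := (strictConcaveOn_rpow hp0 hp1).2 (Set.mem_Ici.2 hx) hx1 (by linarith)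
    (one_half_pos (α := ℝ)) one_half_pos (add_halves 1)
  simp only [smul_eq_mul] at h
  rw [show 1 / 2 * x + 1 / 2 * (x + 1) = x + 1 / 2 by ring] at h
  linarith

/-- Explicit computation of the Haar coefficients of `f_β` (proof of Proposition 2):
for `0 < β < 1/2` and `j ≥ 0`, `β_{(j,k)} = 0` for `k ∉ {0, …, 2^j - 1}` and, for
`0 ≤ k < 2^j`,
`β_{(j,k)} = (1-β)⁻¹ 2^{-j(1/2-β)} (2(k+1/2)^{1-β} - k^{1-β} - (k+1)^{1-β}) > 0`. -/
theorem fBeta_haar_coefficients (b : ℝ) (hb0 : 0 < b) (hb : b < 1 / 2) (j : ℕ) :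
    (∀ k : ℤ, (k < 0 ∨ (2 : ℤ) ^ j ≤ k) → betaW (fBeta b) j k = 0) ∧
    (∀ k : ℤ, 0 ≤ k → k < (2 : ℤ) ^ j →
      betaW (fBeta b) j k =
        (1 - b)⁻¹ * (2 : ℝ) ^ (-(j : ℝ) * (1 / 2 - b)) *
          (2 * ((k : ℝ) + 1 / 2) ^ (1 - b) - (k : ℝ) ^ (1 - b) - ((k : ℝ) + 1) ^ (1 - b)) ∧
      0 < betaW (fBeta b) j k) := by
  refine ⟨betaW_fBeta_eq_zero b j, fun k hk0 hk => ?_⟩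
  have heq := betaW_fBeta_eq b (by linarith) j k hk0 hk
  have hpos := two_mul_midpoint_rpow_sub_pos (p := 1 - b) (by linarith) (by linarith)
    (x := (k : ℝ)) (by exact_mod_cast hk0)
  have hb1 : 0 < (1 - b)⁻¹ := inv_pos.2 (by linarith)
  exact ⟨heq, heq ▸ by positivity⟩
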